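/- For any finite nonempty simple graphs G and H without isolated vertices, γ(G □ H) ≥ (π(G)/(2·π(G)−1)) · γ(G) · γ(H), where □ denotes the Cartesian (box) product of graphs. -/

import Mathlib

open Finset

/-- `s` is a dominating set of `G`: every vertex is in `s` or adjacent to a vertex of `s`. -/
def IsDominatingSet {V : Type*} (G : SimpleGraph V) (s : Set V) : Prop :=
  ∀ v : V, v ∈ s ∨ ∃ u ∈ s, G.Adj u v

/-- The domination number `γ(G)`: minimum cardinality of a dominating set. -/
noncomputable def domNum {V : Type*} [Fintype V] (G : SimpleGraph V) : ℕ :=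
  sInf {n : ℕ | ∃ s : Set V, IsDominatingSet G s ∧ s.ncard = n}

/-- The allegiance `a_G(D) = max_{v ∈ V} |D ∩ N[v]|` (closed neighborhoods). -/
noncomputable def allegiance {V : Type*} [Fintype V] (G : SimpleGraph V) (D : Set V) : ℕ :=
  Finset.univ.sup fun v : V => (D ∩ (insert v (G.neighborSet v))).ncard

/-- The power `π(G)`: minimum allegiance over all minimum dominating sets (γ-sets) of `G`. -/
noncomputable def graphPower {V : Type*} [Fintype V] (G : SimpleGraph V) : ℕ :=
  sInf {a : ℕ | ∃ D : Set V, IsDominatingSet G D ∧ D.ncard = domNum G ∧ allegiance G D = a}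

theorem domNum_le_card {V : Type*} [Fintype V] {G : SimpleGraph V} {s : Finset V}
    (hs : IsDominatingSet G (s : Set V)) : domNum G ≤ #s :=
  Nat.sInf_le ⟨s, hs, Set.ncard_coe_finset s⟩

theorem isDominatingSet_univ {V : Type*} (G : SimpleGraph V) :
    IsDominatingSet G (Set.univ : Set V) := fun _ => Or.inl trivial

theorem exists_isDominatingSet_ncard_eq_domNum {V : Type*} [Fintype V] (G : SimpleGraph V) :
    ∃ s : Set V, IsDominatingSet G s ∧ s.ncard = domNum G :=
  Nat.sInf_mem (s := {n : ℕ | ∃ s : Set V, IsDominatingSet G s ∧ s.ncard = n})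
    ⟨_, Set.univ, isDominatingSet_univ G, rfl⟩

theorem exists_finset_card_eq_domNum {V : Type*} [Fintype V] (G : SimpleGraph V) :
    ∃ s : Finset V, IsDominatingSet G (s : Set V) ∧ #s = domNum G := by
  classical
  obtain ⟨s, hs, hc⟩ := exists_isDominatingSet_ncard_eq_domNum G
  exact ⟨s.toFinset, by simpa using hs, by rw [← hc, Set.ncard_eq_toFinset_card']⟩

open Classical in
/-- A γ-set realizing the power of `G`. -/
theorem exists_finset_card_filter_le_graphPower {V : Type*} [Fintype V] (G : SimpleGraph V) :
    ∃ s : Finset V, IsDominatingSet G (s : Set V) ∧ #s = domNum G ∧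
      ∀ v, #{x ∈ s | x = v ∨ G.Adj x v} ≤ graphPower G := by
  obtain ⟨t, ht, htc⟩ := exists_isDominatingSet_ncard_eq_domNum G
  obtain ⟨s, hs, hc, ha⟩ := Nat.sInf_mem
    (s := {a : ℕ | ∃ D : Set V, IsDominatingSet G D ∧ D.ncard = domNum G ∧ allegiance G D = a})
    ⟨_, t, ht, htc, rfl⟩
  refine ⟨s.toFinset, by simpa using hs, by rw [← hc, Set.ncard_eq_toFinset_card'], fun v => ?_⟩
  have h : (s ∩ insert v (G.neighborSet v)).ncard ≤ allegiance G s :=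
    Finset.le_sup (f := fun v : V => (s ∩ insert v (G.neighborSet v)).ncard) (Finset.mem_univ v)
  rw [ha, ← graphPower] at h
  refine le_trans (le_of_eq ?_) h
  rw [← Set.ncard_coe_finset]
  congr 1
  ext x
  simp [G.adj_comm, and_or_left]

section Assignments

open Classical in
/-- The maps sending every vertex to a member of `s` that dominates it, with the members of `s`
sent to themselves. -/
noncomputable def dominatorMaps {V : Type*} [Fintype V] (G : SimpleGraph V) (s : Finset V) :
    Finset (V → V) :=
  Fintype.piFinset fun g => if g ∈ s then {g} else {x ∈ s | G.Adj x g}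

variable {V : Type*} [Fintype V] {G : SimpleGraph V} {s A : Finset V} {f : V → V}

theorem mem_dominatorMaps :
    f ∈ dominatorMaps G s ↔ (∀ g ∈ s, f g = g) ∧ ∀ g ∉ s, f g ∈ s ∧ G.Adj (f g) g := by
  classical
  rw [dominatorMaps, Fintype.mem_piFinset, ← forall_and]
  refine forall_congr' fun g => ?_
  by_cases hg : g ∈ s <;> simp [hg]

theorem dominatorMaps_nonempty (hs : IsDominatingSet G (s : Set V)) :
    (dominatorMaps G s).Nonempty := by
  classical
  rw [dominatorMaps, Fintype.piFinset_nonempty]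
  intro g
  split_ifs with hg
  · simp
  · obtain h | ⟨u, hu, huv⟩ := hs g
    · exact absurd h hg
    · exact ⟨u, by simpa using ⟨hu, huv⟩⟩

/-- The class of `i` under `f` avoids `A` and is dominated by `A`. -/
def IsDominatedClass (G : SimpleGraph V) (A : Finset V) (f : V → V) (i : V) : Prop :=
  ∀ g, f g = i → g ∉ A ∧ ∃ a ∈ A, G.Adj a g

/-- `i` is outside `A`, and the part of its class under `f` outside `A` is dominated by `A`. -/
def IsDominatedClassOutside (G : SimpleGraph V) (A : Finset V) (f : V → V) (i : V) : Prop :=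
  i ∉ A ∧ ∀ g ∉ A, f g = i → ∃ a ∈ A, G.Adj a g

open Classical in
theorem card_isDominatedClassOutside_le (hs : #s = domNum G) (hf : f ∈ dominatorMaps G s) :
    #{i ∈ s | IsDominatedClassOutside G A f i} ≤ #(A \ s) := by
  rw [mem_dominatorMaps] at hf
  set B : Finset V := {i ∈ s | IsDominatedClassOutside G A f i}
  have hdom : IsDominatingSet G (((A \ s) ∪ (s \ B) : Finset V) : Set V) := by
    have key : ∀ x, x ∈ A ∨ x ∈ s \ B → x ∈ (A \ s) ∪ (s \ B) := by
      intro x hx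
      have hxA : x ∈ B → x ∉ A := fun h => (mem_filter.1 h).2.1
      simp only [mem_union, mem_sdiff] at hx ⊢
      tauto
    intro v
    simp only [mem_coe]
    by_cases hv : v ∈ A
    · exact Or.inl (key v (Or.inl hv))
    by_cases hvB : f v ∈ B
    · obtain ⟨a, ha, hav⟩ := (mem_filter.1 hvB).2.2 v hv rfl
      exact Or.inr ⟨a, key a (Or.inl ha), hav⟩
    by_cases hvs : v ∈ s
    · rw [hf.1 v hvs] at hvB
      exact Or.inl (key v (Or.inr (mem_sdiff.2 ⟨hvs, hvB⟩)))
    · have := hf.2 v hvs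
      exact Or.inr ⟨f v, key _ (Or.inr (mem_sdiff.2 ⟨this.1, hvB⟩)), this.2⟩
  have h1 := domNum_le_card hdom
  have h2 := card_union_le (A \ s) (s \ B)
  have h3 : #(s \ B) + #B = #s := card_sdiff_add_card_eq_card (filter_subset _ _)
  omega

open Classical in
theorem card_isDominatedClassOutside_of_forall_adj_le {p : ℕ}
    (hp : ∀ v, #{x ∈ s | x = v ∨ G.Adj x v} ≤ p + 1) (hf : f ∈ dominatorMaps G s) :
    #{i ∈ s | IsDominatedClassOutside G A f i ∧ ∀ a ∈ A, G.Adj a i → a ∈ s} ≤ p * #(A ∩ s) := by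
  rw [mem_dominatorMaps] at hf
  have hsub : {i ∈ s | IsDominatedClassOutside G A f i ∧ ∀ a ∈ A, G.Adj a i → a ∈ s} ⊆
      (A ∩ s).biUnion fun a => {x ∈ s | G.Adj x a} := by
    intro i hi
    obtain ⟨his, ⟨hiA, hi⟩, hia⟩ := mem_filter.1 hi
    obtain ⟨a, ha, hai⟩ := hi i hiA (hf.1 i his)
    exact mem_biUnion.2 ⟨a, mem_inter.2 ⟨ha, hia a ha hai⟩, mem_filter.2 ⟨his, hai.symm⟩⟩
  refine (card_le_card hsub).trans ((card_biUnion_le_card_mul _ _ p fun a ha => ?_).trans_eq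
    (mul_comm _ _))
  have hlt : #{x ∈ s | G.Adj x a} < #{x ∈ s | x = a ∨ G.Adj x a} := by
    refine card_lt_card ((ssubset_iff_of_subset ?_).2 ⟨a, ?_, ?_⟩)
    · exact monotone_filter_right s fun x _ hx => Or.inr hx
    · exact mem_filter.2 ⟨(mem_inter.1 ha).2, Or.inl rfl⟩
    · simp
  have := hp a
  omega

open Classical in
theorem card_isDominatedClass_add_le {p : ℕ}
    (hp : ∀ v, #{x ∈ s | x = v ∨ G.Adj x v} ≤ p + 1) {i a : V} (hi : i ∈ s) (ha : a ∈ A)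
    (has : a ∉ s) (hai : G.Adj a i) :
    (p + 1) * #{f ∈ dominatorMaps G s | IsDominatedClass G A f i} ≤
      p * #{f ∈ dominatorMaps G s | IsDominatedClassOutside G A f i} := by
  set T := {f ∈ dominatorMaps G s | IsDominatedClassOutside G A f i}
  set T' := {f ∈ T | f a = i}
  have hmaps : ∀ f ∈ T, Function.update f a i ∈ T' := by
    intro f hf
    obtain ⟨hf, hiA, hfi⟩ := mem_filter.1 hf
    rw [mem_dominatorMaps] at hf
    refine mem_filter.2 ⟨mem_filter.2 ⟨mem_dominatorMaps.2 ⟨fun g hg => ?_, fun g hg => ?_⟩,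
      hiA, fun g hg hgi => ?_⟩, by simp⟩
    · rw [Function.update_of_ne (by rintro rfl; exact has hg)]
      exact hf.1 g hg
    · rcases eq_or_ne g a with rfl | hga
      · simpa using ⟨hi, hai.symm⟩
      · rw [Function.update_of_ne hga]
        exact hf.2 g hg
    · rw [Function.update_of_ne (by rintro rfl; exact hg ha)] at hgi
      exact hfi g hg hgi
  have hfiber : #T ≤ (p + 1) * #T' := by
    refine card_le_mul_card_image_of_maps_to hmaps (p + 1) fun b _ => le_trans ?_ (hp a)
    refine card_le_card_of_injOn (fun f => f a) (fun f hf => ?_) fun f hf f' hf' hff => ?_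
    · have := (mem_dominatorMaps.1 (mem_filter.1 (mem_filter.1 hf).1).1).2 a has
      exact mem_filter.2 ⟨this.1, Or.inr this.2⟩
    · have h : Function.update f a i = Function.update f' a i :=
        (mem_filter.1 hf).2.trans (mem_filter.1 hf').2.symm
      funext g
      rcases eq_or_ne g a with rfl | hga
      · exact hff
      · simpa [hga] using congrFun h g
  have hsub : {f ∈ dominatorMaps G s | IsDominatedClass G A f i} ⊆ T \ T' := by
    intro f hf
    obtain ⟨hf, hfi⟩ := mem_filter.1 hf
    refine mem_sdiff.2 ⟨mem_filter.2 ⟨hf, ?_, fun g _ hg => (hfi g hg).2⟩, fun h => ?_⟩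
    · exact (hfi i ((mem_dominatorMaps.1 hf).1 i hi)).1
    · exact (hfi a (mem_filter.1 h).2).1 ha
  have h1 := card_le_card hsub
  have h2 : #(T \ T') + #T' = #T := card_sdiff_add_card_eq_card (filter_subset _ _)
  nlinarith

open Classical in
theorem sum_card_isDominatedClass_le {p : ℕ} (hs : #s = domNum G)
    (hp : ∀ v, #{x ∈ s | x = v ∨ G.Adj x v} ≤ p + 1) :
    (p + 1) * ∑ f ∈ dominatorMaps G s, #{i ∈ s | IsDominatedClass G A f i} ≤
      #(dominatorMaps G s) * (p * #A) := by
  have hswap : ∀ (P : (V → V) → V → Prop) [∀ f i, Decidable (P f i)],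
      ∑ f ∈ dominatorMaps G s, #{i ∈ s | P f i} = ∑ i ∈ s, #{f ∈ dominatorMaps G s | P f i} :=
    fun P _ => sum_card_bipartiteAbove_eq_sum_card_bipartiteBelow P
  calc
    _ = ∑ i ∈ s, (p + 1) * #{f ∈ dominatorMaps G s | IsDominatedClass G A f i} := by
      rw [hswap, mul_sum]
    _ ≤ ∑ i ∈ s, (p * #{f ∈ dominatorMaps G s | IsDominatedClassOutside G A f i} +
        #{f ∈ dominatorMaps G s |
          IsDominatedClassOutside G A f i ∧ ∀ a ∈ A, G.Adj a i → a ∈ s}) := by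
      refine sum_le_sum fun i hi => ?_
      by_cases h : ∀ a ∈ A, G.Adj a i → a ∈ s
      · have hle : #{f ∈ dominatorMaps G s | IsDominatedClass G A f i} ≤
            #{f ∈ dominatorMaps G s | IsDominatedClassOutside G A f i} :=
          card_le_card (monotone_filter_right _ fun f hf hfi =>
            ⟨(hfi i ((mem_dominatorMaps.1 hf).1 i hi)).1, fun g _ hg => (hfi g hg).2⟩)
        have hle' : #{f ∈ dominatorMaps G s | IsDominatedClassOutside G A f i} ≤
            #{f ∈ dominatorMaps G s |
              IsDominatedClassOutside G A f i ∧ ∀ a ∈ A, G.Adj a i → a ∈ s} :=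
          card_le_card (monotone_filter_right _ fun _ _ hfi => ⟨hfi, h⟩)
        nlinarith
      · push Not at h
        obtain ⟨a, ha, hai, has⟩ := h
        exact (card_isDominatedClass_add_le hp hi ha has hai).trans (Nat.le_add_right _ _)
    _ = ∑ f ∈ dominatorMaps G s, (p * #{i ∈ s | IsDominatedClassOutside G A f i} +
        #{i ∈ s | IsDominatedClassOutside G A f i ∧ ∀ a ∈ A, G.Adj a i → a ∈ s}) := by
      rw [sum_add_distrib, sum_add_distrib, ← mul_sum, ← mul_sum, hswap,
        hswap fun f i => IsDominatedClassOutside G A f i ∧ ∀ a ∈ A, G.Adj a i → a ∈ s]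
    _ ≤ ∑ f ∈ dominatorMaps G s, p * #A := by
      refine sum_le_sum fun f hf => ?_
      have h1 := card_isDominatedClassOutside_le (A := A) hs hf
      have h2 := card_isDominatedClassOutside_of_forall_adj_le (A := A) hp hf
      have h3 := card_sdiff_add_card_inter A s
      nlinarith
    _ = _ := by rw [sum_const, smul_eq_mul]

open Classical in
theorem mul_domNum_le_card_add_sum {W : Type*} [Fintype W] {H : SimpleGraph W}
    {D : Finset (V × W)} (hD : IsDominatingSet (G □ H) (D : Set (V × W)))
    (hf : f ∈ dominatorMaps G s) :
    #s * domNum H ≤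
      #D + ∑ h : W, #{i ∈ s | IsDominatedClass G {g | (g, h) ∈ D} f i} := by
  have hfs : ∀ g, f g ∈ s := fun g => by
    rw [mem_dominatorMaps] at hf
    by_cases hg : g ∈ s
    · rwa [hf.1 g hg]
    · exact (hf.2 g hg).1
  have hclass : ∀ i ∈ s, domNum H ≤ #{d ∈ D | f d.1 = i} +
      #{h : W | IsDominatedClass G {g | (g, h) ∈ D} f i} := by
    intro i _
    set S : Finset W := {d ∈ D | f d.1 = i}.image Prod.snd
    set T : Finset W := {h : W | IsDominatedClass G {g | (g, h) ∈ D} f i}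
    have hdom : IsDominatingSet H ((S ∪ T : Finset W) : Set W) := by
      intro h
      by_cases hh : IsDominatedClass G {g | (g, h) ∈ D} f i
      · exact Or.inl (mem_union_right _ (mem_filter.2 ⟨mem_univ _, hh⟩))
      have hmem : ∀ g w, (g, w) ∈ D → f g = i → w ∈ S ∪ T := fun g w hd hg =>
        mem_union_left _ (mem_image.2 ⟨(g, w), mem_filter.2 ⟨hd, hg⟩, rfl⟩)
      simp only [IsDominatedClass, not_forall, mem_filter_univ] at hh
      obtain ⟨g, hg, hh⟩ := hh
      by_cases hgD : (g, h) ∈ D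
      · exact Or.inl (hmem g h hgD hg)
      obtain h' | ⟨⟨g', w⟩, hd, hadj⟩ := hD (g, h)
      · exact absurd h' hgD
      rw [SimpleGraph.boxProd_adj] at hadj
      obtain ⟨hgg, rfl : w = h⟩ | ⟨hwh, rfl : g' = g⟩ := hadj
      · exact absurd ⟨hgD, g', hd, hgg⟩ hh
      · exact Or.inr ⟨w, hmem g' w hd hg, hwh⟩
    exact (domNum_le_card hdom).trans ((card_union_le _ _).trans
      (Nat.add_le_add_right card_image_le _))
  calc
    #s * domNum H = ∑ i ∈ s, domNum H := by rw [sum_const, smul_eq_mul]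
    _ ≤ _ := sum_le_sum hclass
    _ = _ := by
      rw [sum_add_distrib, ← card_eq_sum_card_fiberwise (f := fun d : V × W => f d.1)
        (fun d _ => hfs d.1)]
      congr 1
      exact (sum_card_bipartiteAbove_eq_sum_card_bipartiteBelow
        (fun (h : W) (i : V) => IsDominatedClass G {g | (g, h) ∈ D} f i)).symm

open Classical in
theorem mul_domNum_le_mul_card {W : Type*} [Fintype W] {H : SimpleGraph W} {p : ℕ}
    {D : Finset (V × W)} (hD : IsDominatingSet (G □ H) (D : Set (V × W)))
    (hsd : IsDominatingSet G (s : Set V)) (hs : #s = domNum G)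
    (hp : ∀ v, #{x ∈ s | x = v ∨ G.Adj x v} ≤ p + 1) :
    (p + 1) * (domNum G * domNum H) ≤ (2 * p + 1) * #D := by
  have hDcard : ∑ h : W, #({g | (g, h) ∈ D} : Finset V) = #D := by
    rw [card_eq_sum_card_fiberwise (f := Prod.snd) (t := univ) (fun _ _ => by simp)]
    refine sum_congr rfl fun h _ => card_nbij' (fun g => (g, h)) Prod.fst ?_ ?_ ?_ ?_ <;>
      simp +contextual [Set.MapsTo, Set.LeftInvOn, Set.RightInvOn]
    rintro a b h rfl
    exact h
  have h1 := sum_le_sum fun f hf => mul_domNum_le_card_add_sum (G := G) (s := s) (f := f) hD hf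
  rw [sum_const, smul_eq_mul, sum_add_distrib, sum_const, smul_eq_mul, sum_comm, hs] at h1
  have h2 := sum_le_sum fun (h : W) (_ : h ∈ univ) =>
    sum_card_isDominatedClass_le (A := {g | (g, h) ∈ D}) hs hp
  rw [← mul_sum, ← mul_sum, ← mul_sum, hDcard] at h2
  have hpos := (dominatorMaps_nonempty hsd).card_pos
  refine Nat.le_of_mul_le_mul_left ?_ hpos
  nlinarith [Nat.mul_le_mul_left (p + 1) h1]

end Assignments

/-- For finite nonempty graphs `G`, `H` without isolated vertices,
`γ(G □ H) ≥ (π(G)/(2π(G)−1))·γ(G)·γ(H)`. -/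
theorem domNum_boxProd_ge_power_bound {V W : Type*} [Fintype V] [Fintype W]
    [Nonempty V] [Nonempty W] (G : SimpleGraph V) (H : SimpleGraph W)
    (hG : ∀ v : V, ∃ u : V, G.Adj u v) (hH : ∀ w : W, ∃ u : W, H.Adj u w) :
    (domNum (G □ H) : ℝ) ≥
      (graphPower G : ℝ) / (2 * (graphPower G : ℝ) - 1) * (domNum G : ℝ) * (domNum H : ℝ) := by
  classical
  obtain ⟨s, hsd, hs, hp⟩ := exists_finset_card_filter_le_graphPower G
  obtain ⟨D, hD, hDc⟩ := exists_finset_card_eq_domNum (G □ H)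
  have hpos : 0 < graphPower G := by
    let v := Classical.arbitrary V
    refine lt_of_lt_of_le (card_pos.2 ?_) (hp v)
    obtain h | ⟨u, hu, huv⟩ := hsd v
    · exact ⟨v, mem_filter.2 ⟨h, Or.inl rfl⟩⟩
    · exact ⟨u, mem_filter.2 ⟨hu, Or.inr huv⟩⟩
  obtain ⟨p, hpe⟩ := Nat.exists_eq_add_of_lt hpos
  rw [zero_add] at hpe
  rw [hpe] at hp ⊢
  have h := mul_domNum_le_mul_card hD hsd hs fun v => by convert hp v
  rw [hDc] at h
  have h' : ((p : ℝ) + 1) * (domNum G * domNum H) ≤ (2 * p + 1) * domNum (G □ H) := by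
    exact_mod_cast h
  have hden : (0 : ℝ) < 2 * ((p : ℝ) + 1) - 1 := by
    have : (0 : ℝ) ≤ p := p.cast_nonneg
    linarith
  push_cast
  rw [ge_iff_le, mul_assoc, div_mul_eq_mul_div, div_le_iff₀ hden]
  linarith
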